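/- Let y : ℝⁿ → ℝⁿ be the gradient map ∇g of a C², μ-strongly convex function g (μ > 0). Then ∇g is a bijection from ℝⁿ onto ℝⁿ, and it is a global C¹ diffeomorphism: ∇g is continuously differentiable, its inverse map (∇g)⁻¹ : ℝⁿ → ℝⁿ is well defined and continuously differentiable. -/

import Mathlib

open Set Filter Topology Function

variable {E : Type*} [NormedAddCommGroup E]

theorem ConvexOn.fderiv_monotone [NormedSpace ℝ E] {f : E → ℝ} (hf : ConvexOn ℝ Set.univ f)
    {x y : E} {f'x f'y : E →L[ℝ] ℝ} (hx : HasFDerivAt f f'x x) (hy : HasFDerivAt f f'y y) :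
    0 ≤ (f'y - f'x) (y - x) := by
  have hc := hf.comp_affineMap (AffineMap.lineMap (k := ℝ) x y)
  have h0 : HasDerivAt (f ∘ AffineMap.lineMap (k := ℝ) x y) (f'x (y - x)) 0 :=
    HasFDerivAt.comp_hasDerivAt (0 : ℝ) (by simpa using hx) AffineMap.hasDerivAt_lineMap
  have h1 : HasDerivAt (f ∘ AffineMap.lineMap (k := ℝ) x y) (f'y (y - x)) 1 :=
    HasFDerivAt.comp_hasDerivAt (1 : ℝ) (by simpa using hy) AffineMap.hasDerivAt_lineMap
  have := (hc.le_slope_of_hasDerivAt trivial trivial zero_lt_one h0).trans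
    (hc.slope_le_of_hasDerivAt trivial trivial zero_lt_one h1)
  simpa using this

variable [InnerProductSpace ℝ E]

theorem inner_gradient_sub_ge [CompleteSpace E] {μ : ℝ} {g : E → ℝ} (hg : Differentiable ℝ g)
    (hsc : ConvexOn ℝ Set.univ fun x => g x - μ / 2 * ‖x‖ ^ 2) (x y : E) :
    μ * ‖x - y‖ ^ 2 ≤ inner ℝ (gradient g x - gradient g y) (x - y) := by
  have hd (z : E) : HasFDerivAt (fun x => g x - μ / 2 * ‖x‖ ^ 2)
      (fderiv ℝ g z - (μ / 2) • (2 • innerSL ℝ z)) z :=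
    (hg z).hasFDerivAt.sub ((hasStrictFDerivAt_norm_sq z).hasFDerivAt.const_mul (μ / 2))
  have h := hsc.fderiv_monotone (hd y) (hd x)
  simp only [inner_sub_left, gradient, InnerProductSpace.toDual_symm_apply]
  simp [inner_sub_right, real_inner_comm x y, norm_sub_sq_real] at h ⊢
  linarith

theorem AntilipschitzWith.of_strongly_monotone {μ : ℝ} (hμ : 0 < μ) {Φ : E → E}
    (h : ∀ x y, μ * ‖x - y‖ ^ 2 ≤ inner ℝ (Φ x - Φ y) (x - y)) :
    AntilipschitzWith (μ⁻¹).toNNReal Φ := by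
  refine AntilipschitzWith.of_le_mul_dist fun x y => ?_
  rw [Real.coe_toNNReal _ (inv_pos.2 hμ).le, dist_eq_norm, dist_eq_norm, inv_mul_eq_div,
    le_div_iff₀ hμ]
  rcases (norm_nonneg (x - y)).eq_or_lt with h0 | h0
  · simp [← h0]
  · have := (h x y).trans (real_inner_le_norm _ _)
    nlinarith

theorem fderiv_inner_ge_of_strongly_monotone {μ : ℝ} {Φ : E → E} {x : E} {A : E →L[ℝ] E}
    (hA : HasFDerivAt Φ A x) (h : ∀ x y, μ * ‖x - y‖ ^ 2 ≤ inner ℝ (Φ x - Φ y) (x - y)) (v : E) :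
    μ * ‖v‖ ^ 2 ≤ inner ℝ (A v) v := by
  have hl := (hA.hasLineDerivAt v).tendsto_slope_zero_right.inner (𝕜 := ℝ)
    (tendsto_const_nhds (x := v))
  refine ge_of_tendsto hl ?_
  filter_upwards [self_mem_nhdsWithin] with t (ht : 0 < t)
  have := h (x + t • v) x
  simp only [add_sub_cancel_left, norm_smul, inner_smul_right, Real.norm_eq_abs, mul_pow,
    sq_abs] at this
  rw [real_inner_smul_left]
  rw [inv_mul_eq_div, le_div_iff₀ ht]
  nlinarith

theorem exists_homeomorph_of_strongly_monotone [FiniteDimensional ℝ E] {μ : ℝ} (hμ : 0 < μ)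
    {Φ : E → E} (hΦ : ContDiff ℝ 1 Φ)
    (h : ∀ x y, μ * ‖x - y‖ ^ 2 ≤ inner ℝ (Φ x - Φ y) (x - y)) :
    ∃ e : E ≃ₜ E, ⇑e = Φ ∧ ContDiff ℝ 1 e.symm := by
  have hanti := AntilipschitzWith.of_strongly_monotone hμ h
  have hinj (x : E) : Injective (fderiv ℝ Φ x) := by
    refine (injective_iff_map_eq_zero _).2 fun v hv => ?_
    have := fderiv_inner_ge_of_strongly_monotone
      (hΦ.differentiable one_ne_zero x).hasFDerivAt h v
    rw [hv, inner_zero_left] at this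
    by_contra hv0
    have := norm_pos_iff.2 hv0
    have : 0 < μ * ‖v‖ ^ 2 := by positivity
    linarith
  let D (x : E) : E ≃L[ℝ] E :=
    (LinearEquiv.ofInjectiveEndo (fderiv ℝ Φ x).toLinearMap (hinj x)).toContinuousLinearEquiv
  have hD (x : E) : (D x : E →L[ℝ] E) = fderiv ℝ Φ x := by ext; rfl
  have hopen : IsOpenMap Φ := isOpenMap_of_hasStrictFDerivAt_equiv (f' := D) fun x => by
    rw [hD]
    exact hΦ.contDiffAt.hasStrictFDerivAt one_ne_zero
  have hclosed : IsClosed (Set.range Φ) := by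
    refine IsProperMap.isClosedMap ?_ |>.isClosed_range
    rw [isProperMap_iff_tendsto_cocompact]
    refine ⟨hΦ.continuous, ?_⟩
    simpa only [Metric.cobounded_eq_cocompact] using hanti.tendsto_cobounded
  have hsurj : Surjective Φ := Set.range_eq_univ.1 <|
    IsClopen.eq_univ ⟨hclosed, hopen.isOpen_range⟩ (Set.range_nonempty Φ)
  let e : E ≃ₜ E := (Equiv.ofBijective Φ ⟨hanti.injective, hsurj⟩).toHomeomorphOfContinuousOpen
    hΦ.continuous hopen
  refine ⟨e, rfl, e.contDiff_symm (f₀' := D) (fun x => ?_) hΦ⟩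
  rw [hD]
  exact (hΦ.differentiable one_ne_zero x).hasFDerivAt

theorem ContDiff.gradient [CompleteSpace E] {g : E → ℝ} {m n : WithTop ℕ∞} (hg : ContDiff ℝ n g)
    (hmn : m + 1 ≤ n) : ContDiff ℝ m (gradient g) :=
  (InnerProductSpace.toDual ℝ E).symm.contDiff.comp (hg.fderiv_right hmn)

/-- The gradient of a `C²`, `μ`-strongly convex function on `ℝⁿ`
is a bijection of `ℝⁿ` and a global `C¹` diffeomorphism: `∇g` is `C¹`, its inverse
map is well defined (a two-sided inverse), and the inverse is `C¹` as well. -/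
theorem stmt_0 (n : ℕ) (hn : 1 ≤ n) (μ : ℝ) (hμ : 0 < μ)
    (g : EuclideanSpace ℝ (Fin n) → ℝ)
    (hg : ContDiff ℝ 2 g)
    (hsc : ConvexOn ℝ Set.univ (fun x => g x - μ / 2 * ‖x‖ ^ 2)) :
    Function.Bijective (gradient g) ∧
    ContDiff ℝ 1 (gradient g) ∧
    Function.LeftInverse (Function.invFun (gradient g)) (gradient g) ∧
    Function.RightInverse (Function.invFun (gradient g)) (gradient g) ∧
    ContDiff ℝ 1 (Function.invFun (gradient g)) := by
  have hgrad : ContDiff ℝ 1 (gradient g) := hg.gradient (by norm_num)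
  obtain ⟨e, he, hsymm⟩ := exists_homeomorph_of_strongly_monotone hμ hgrad
    (inner_gradient_sub_ge (hg.differentiable two_ne_zero) hsc)
  have hbij : Bijective (gradient g) := he ▸ e.bijective
  have hleft := leftInverse_invFun hbij.injective
  have hright := rightInverse_invFun hbij.surjective
  have hinv : invFun (gradient g) = e.symm :=
    hleft.eq_rightInverse (he ▸ e.apply_symm_apply)
  exact ⟨hbij, hgrad, hleft, hright, hinv ▸ hsymm⟩
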